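/- (Decay of the Riemann invariants.) Let (η, λ, r, s) be a regular solution on [1,T). Then for every (t,x) ∈ [1,T) × ℝ one has r(t,x) ≤ (sup_{y∈ℝ} r(1,y)) / t and s(t,x) ≤ (sup_{y∈ℝ} s(1,y)) / t. -/

import Mathlib

open Real Set MeasureTheory

noncomputable section

/-- Partial derivative with respect to the time variable `t`. -/
def pderivT (f : ℝ → ℝ → ℝ) (t x : ℝ) : ℝ := deriv (fun τ => f τ x) t

/-- Partial derivative with respect to the space variable `x`. -/
def pderivX (f : ℝ → ℝ → ℝ) (t x : ℝ) : ℝ := deriv (fun y => f t y) x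

/-- The time interval `[1, T)` for a (possibly infinite) final time `T ∈ (1,∞]`. -/
def timeSlab (T : EReal) : Set ℝ := {t : ℝ | 1 ≤ t ∧ (t : EReal) < T}

/-- A regular solution of the plane-symmetric Einstein–stiff fluid equations in areal
coordinates, with cosmological constant `Λ`, on a time interval `J`:
continuously differentiable functions `η, λ, r, s`, 1-periodic in the space variable,
with `r ≥ 0`, `s ≥ 0`, satisfying the evolution and constraint equations (E1)–(E5). -/
structure RegularSolution (Λ : ℝ) (J : Set ℝ) where
  η : ℝ → ℝ → ℝ
  lam : ℝ → ℝ → ℝ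
  r : ℝ → ℝ → ℝ
  s : ℝ → ℝ → ℝ
  η_c1 : ContDiffOn ℝ 1 (fun p : ℝ × ℝ => η p.1 p.2) (J ×ˢ (Set.univ : Set ℝ))
  lam_c1 : ContDiffOn ℝ 1 (fun p : ℝ × ℝ => lam p.1 p.2) (J ×ˢ (Set.univ : Set ℝ))
  r_c1 : ContDiffOn ℝ 1 (fun p : ℝ × ℝ => r p.1 p.2) (J ×ˢ (Set.univ : Set ℝ))
  s_c1 : ContDiffOn ℝ 1 (fun p : ℝ × ℝ => s p.1 p.2) (J ×ˢ (Set.univ : Set ℝ))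
  η_per : ∀ t ∈ J, ∀ x : ℝ, η t (x + 1) = η t x
  lam_per : ∀ t ∈ J, ∀ x : ℝ, lam t (x + 1) = lam t x
  r_per : ∀ t ∈ J, ∀ x : ℝ, r t (x + 1) = r t x
  s_per : ∀ t ∈ J, ∀ x : ℝ, s t (x + 1) = s t x
  r_nonneg : ∀ t ∈ J, ∀ x : ℝ, 0 ≤ r t x
  s_nonneg : ∀ t ∈ J, ∀ x : ℝ, 0 ≤ s t x
  eqE1 : ∀ t ∈ J, ∀ x : ℝ,
    Real.exp (-2 * η t x) * (2 * t * pderivT lam t x + 1) - Λ * t ^ 2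
      = 4 * Real.pi * t ^ 2 * (r t x + s t x)
  eqE2 : ∀ t ∈ J, ∀ x : ℝ,
    Real.exp (-2 * η t x) * (2 * t * pderivT η t x - 1) + Λ * t ^ 2
      = 4 * Real.pi * t ^ 2 * (r t x + s t x)
  eqE3 : ∀ t ∈ J, ∀ x : ℝ,
    pderivX η t x = -(2 * Real.pi * t * Real.exp (lam t x + η t x) * (r t x - s t x))
  eqE4 : ∀ t ∈ J, ∀ x : ℝ,
    pderivT r t x + Real.exp (η t x - lam t x) * pderivX r t x
      = -2 * (pderivT lam t x + Real.exp (η t x - lam t x) * pderivX η t x + 1 / t) * r t x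
        - 2 / t * Real.sqrt (r t x * s t x)
  eqE5 : ∀ t ∈ J, ∀ x : ℝ,
    pderivT s t x - Real.exp (η t x - lam t x) * pderivX s t x
      = -2 * (pderivT lam t x - Real.exp (η t x - lam t x) * pderivX η t x + 1 / t) * s t x
        - 2 / t * Real.sqrt (r t x * s t x)

/-- The derivative at `b` of a function whose maximum over `[a, b]` is at `b` is nonnegative. -/
theorem HasDerivAt.nonneg_of_forall_Icc_le {g : ℝ → ℝ} {g' a b : ℝ} (hab : a < b)
    (hg : HasDerivAt g g' b) (hmax : ∀ τ ∈ Icc a b, g τ ≤ g b) : 0 ≤ g' := by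
  have hslope := (hasDerivAt_iff_tendsto_slope.1 hg).mono_left
    (nhdsWithin_mono b (fun y (hy : y ∈ Iio b) => ne_of_lt hy))
  refine ge_of_tendsto hslope ?_
  filter_upwards [Ioo_mem_nhdsLT hab] with τ hτ
  rw [slope_def_field]
  exact div_nonneg_of_nonpos (sub_nonpos.2 (hmax τ ⟨hτ.1.le, hτ.2.le⟩)) (sub_nonpos.2 hτ.2.le)

/-- A function that is continuous on `K ×ˢ univ`, with `K` compact, and 1-periodic in the second
variable attains its maximum. -/
theorem exists_forall_le_of_periodic {K : Set ℝ} (hK : IsCompact K) (hne : K.Nonempty)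
    {f : ℝ → ℝ → ℝ} (hf : ContinuousOn (fun p : ℝ × ℝ => f p.1 p.2) (K ×ˢ univ))
    (hper : ∀ t ∈ K, ∀ x, f t (x + 1) = f t x) :
    ∃ t ∈ K, ∃ x, ∀ τ ∈ K, ∀ y, f τ y ≤ f t x := by
  obtain ⟨⟨t, x⟩, ⟨ht, -⟩, hmax⟩ := (hK.prod (isCompact_Icc (a := (0 : ℝ)) (b := 1))).exists_isMaxOn
    (hne.prod ⟨0, by simp⟩) (hf.mono (prod_mono_right (subset_univ _)))
  refine ⟨t, ht, x, fun τ hτ y => ?_⟩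
  obtain ⟨z, hz, hyz⟩ := Function.Periodic.exists_mem_Ico₀ (f := f τ) (hper τ hτ) one_pos y
  rw [hyz]
  exact hmax (show (τ, z) ∈ K ×ˢ Icc (0 : ℝ) 1 from ⟨hτ, hz.1, hz.2.le⟩)

/-- Maximum principle for subsolutions of a transport equation that are periodic in space. -/
theorem le_iSup_of_transport_nonpos {T : EReal} {f c : ℝ → ℝ → ℝ}
    (hf : ContinuousOn (fun p : ℝ × ℝ => f p.1 p.2) (timeSlab T ×ˢ univ))
    (hdiff : ∀ t ∈ timeSlab T, 1 < t → ∀ x, DifferentiableAt ℝ (fun τ => f τ x) t)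
    (hper : ∀ t ∈ timeSlab T, ∀ x, f t (x + 1) = f t x)
    (hle : ∀ t ∈ timeSlab T, 1 < t → ∀ x, pderivT f t x + c t x * pderivX f t x ≤ 0)
    {t : ℝ} (ht : t ∈ timeSlab T) (x : ℝ) : f t x ≤ ⨆ y, f 1 y := by
  have hsub : Icc 1 t ⊆ timeSlab T := fun τ hτ =>
    ⟨hτ.1, (EReal.coe_le_coe_iff.2 hτ.2).trans_lt ht.2⟩
  have h1 : (1 : ℝ) ∈ Icc 1 t := ⟨le_rfl, ht.1⟩
  have hbdd : BddAbove (range (f 1)) := by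
    obtain ⟨τ, hτ, y, hy⟩ := exists_forall_le_of_periodic isCompact_Icc ⟨1, h1⟩
      (hf.mono (prod_mono_left hsub)) (fun τ hτ => hper τ (hsub hτ))
    exact ⟨f τ y, by rintro _ ⟨z, rfl⟩; exact hy 1 h1 z⟩
  have key : ∀ ε > 0, f t x - ε * (t - 1) ≤ ⨆ y, f 1 y := by
    intro ε hε
    obtain ⟨t₁, ht₁, x₁, hmax⟩ := exists_forall_le_of_periodic
      (f := fun τ y => f τ y - ε * (τ - 1)) isCompact_Icc ⟨1, h1⟩
      ((hf.mono (prod_mono_left hsub)).sub (by fun_prop))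
      (fun τ hτ y => by simp only [hper τ (hsub hτ) y])
    refine (hmax t ⟨ht.1, le_rfl⟩ x).trans ?_
    rcases ht₁.1.eq_or_lt with rfl | hlt
    · simpa using le_ciSup hbdd x₁
    · exfalso
      have hx : pderivX f t₁ x₁ = 0 :=
        IsLocalMax.deriv_eq_zero (Filter.Eventually.of_forall fun y => by
          simpa using hmax t₁ ht₁ y)
      have hd : HasDerivAt (fun τ => f τ x₁ - ε * (τ - 1)) (pderivT f t₁ x₁ - ε * 1) t₁ :=
        (hdiff t₁ (hsub ht₁) hlt x₁).hasDerivAt.sub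
          (((hasDerivAt_id t₁).sub_const 1).const_mul ε)
      have hnn := hd.nonneg_of_forall_Icc_le hlt
        (fun τ hτ => hmax τ ⟨hτ.1, hτ.2.trans ht₁.2⟩ x₁)
      have := hle t₁ (hsub ht₁) hlt x₁
      rw [hx, mul_zero] at this
      linarith
  rcases ht.1.eq_or_lt with rfl | hlt
  · exact le_ciSup hbdd x
  · refine le_of_forall_pos_le_add fun δ hδ => ?_
    have hpos := sub_pos.2 hlt
    have := key (δ / (t - 1)) (div_pos hδ hpos)
    rw [div_mul_cancel₀ _ hpos.ne'] at this
    linarith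

theorem timeSlab_mem_nhds {T : EReal} {t : ℝ} (ht : t ∈ timeSlab T) (h1 : 1 < t) :
    timeSlab T ∈ nhds t := by
  filter_upwards [lt_mem_nhds h1,
    continuous_coe_real_ereal.continuousAt.eventually (gt_mem_nhds ht.2)] with τ h h'
  exact ⟨h.le, h'⟩

/-- If the time-weighted function `t * f` is a subsolution of a transport equation,
then `f` decays like `1 / t`. -/
theorem le_iSup_div_of_transport {T : EReal} {f c : ℝ → ℝ → ℝ}
    (hf : ContDiffOn ℝ 1 (fun p : ℝ × ℝ => f p.1 p.2) (timeSlab T ×ˢ univ))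
    (hper : ∀ t ∈ timeSlab T, ∀ x, f t (x + 1) = f t x)
    (hle : ∀ t ∈ timeSlab T, ∀ x, pderivT f t x + c t x * pderivX f t x ≤ -(f t x / t))
    {t : ℝ} (ht : t ∈ timeSlab T) (x : ℝ) : f t x ≤ (⨆ y, f 1 y) / t := by
  have hdiff : ∀ t ∈ timeSlab T, 1 < t → ∀ x, DifferentiableAt ℝ (fun τ => f τ x) t := by
    intro t ht h1 x
    have hfx : DifferentiableAt ℝ (fun p : ℝ × ℝ => f p.1 p.2) (t, x) :=
      (hf.contDiffAt (prod_mem_nhds (timeSlab_mem_nhds ht h1) Filter.univ_mem)).differentiableAt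
        one_ne_zero
    exact hfx.comp t (f := fun τ : ℝ => (τ, x)) (by fun_prop)
  have hmain := le_iSup_of_transport_nonpos (f := fun t x => t * f t x) (c := c)
    (continuousOn_fst.mul hf.continuousOn)
    (fun t ht h1 x => differentiableAt_id.mul (hdiff t ht h1 x))
    (fun t ht x => by simp only [hper t ht x])
    (fun t ht h1 x => by
      have hT : pderivT (fun t x => t * f t x) t x = 1 * f t x + t * pderivT f t x :=
        ((hasDerivAt_id t).mul (hdiff t ht h1 x).hasDerivAt).deriv
      have hX : pderivX (fun t x => t * f t x) t x = t * pderivX f t x :=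
        deriv_const_mul_field t
      have h0 : 0 < t := one_pos.trans h1
      have := mul_le_mul_of_nonneg_left (hle t ht x) h0.le
      rw [mul_neg, mul_div_cancel₀ _ h0.ne'] at this
      rw [hT, hX]
      linarith) ht x
  rw [le_div_iff₀ (one_pos.trans_le ht.1), mul_comm]
  simpa using hmain

/-- Algebraic form of the damping of a Riemann invariant `a` with companion invariant `b`. -/
theorem damping_le {Λ t a b E L X D Q : ℝ} (hΛ : 0 < Λ) (ht : 1 ≤ t) (ha : 0 ≤ a) (hb : 0 ≤ b)
    (hE : 0 < E) (hQ : 0 ≤ Q)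
    (hL : E⁻¹ * (2 * t * L + 1) - Λ * t ^ 2 = 4 * Real.pi * t ^ 2 * (a + b))
    (hX : X = -(2 * Real.pi * t * E * (a - b)))
    (hD : D = -2 * (L + X + 1 / t) * a - 2 / t * Q) : D ≤ -(a / t) := by
  have h0 : 0 < t := one_pos.trans_le ht
  have hL' : L = (E * (4 * Real.pi * t ^ 2 * (a + b) + Λ * t ^ 2) - 1) / (2 * t) := by
    rw [← hL]
    field_simp
    ring
  have hdamp : D = -(a / t) - (E * (8 * Real.pi * t * b + Λ * t) * a + 2 / t * Q) := by
    rw [hD, hX, hL']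
    field_simp
    ring
  have : 0 ≤ E * (8 * Real.pi * t * b + Λ * t) * a + 2 / t * Q := by
    have := Real.pi_pos
    positivity
  linarith

/-- Decay of the Riemann invariants. -/
theorem riemann_invariant_decay (Λ : ℝ) (hΛ : 0 < Λ) (T : EReal) (hT : 1 < T)
    (sol : RegularSolution Λ (timeSlab T)) :
    ∀ t ∈ timeSlab T, ∀ x : ℝ,
      sol.r t x ≤ (⨆ y : ℝ, sol.r 1 y) / t ∧ sol.s t x ≤ (⨆ y : ℝ, sol.s 1 y) / t := by
  intro t ht x
  have hEinv : ∀ z : ℝ, Real.exp (-2 * z) = (Real.exp (2 * z))⁻¹ := fun z => by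
    rw [← Real.exp_neg, neg_mul]
  have hspeed : ∀ t ∈ timeSlab T, ∀ x, Real.exp (sol.η t x - sol.lam t x) * pderivX sol.η t x
      = -(2 * Real.pi * t * Real.exp (2 * sol.η t x) * (sol.r t x - sol.s t x)) := by
    intro t ht x
    have : Real.exp (2 * sol.η t x) =
        Real.exp (sol.η t x - sol.lam t x) * Real.exp (sol.lam t x + sol.η t x) := by
      rw [← Real.exp_add]
      ring_nf
    rw [sol.eqE3 t ht x, this]
    ring
  constructor
  · refine le_iSup_div_of_transport (c := fun t x => Real.exp (sol.η t x - sol.lam t x))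
      sol.r_c1 sol.r_per (fun t ht x => ?_) ht x
    have hE1 := sol.eqE1 t ht x
    rw [hEinv] at hE1
    exact damping_le hΛ ht.1 (sol.r_nonneg t ht x) (sol.s_nonneg t ht x) (Real.exp_pos _)
      (Real.sqrt_nonneg _) hE1 (hspeed t ht x) (sol.eqE4 t ht x)
  · refine le_iSup_div_of_transport (c := fun t x => -Real.exp (sol.η t x - sol.lam t x))
      sol.s_c1 sol.s_per (fun t ht x => ?_) ht x
    have hE1 := sol.eqE1 t ht x
    rw [hEinv, add_comm (sol.r t x)] at hE1
    refine damping_le (X := -(Real.exp (sol.η t x - sol.lam t x) * pderivX sol.η t x))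
      hΛ ht.1 (sol.s_nonneg t ht x) (sol.r_nonneg t ht x) (Real.exp_pos _)
      (Real.sqrt_nonneg (sol.r t x * sol.s t x)) hE1 ?_ ?_
    · rw [hspeed t ht x]
      ring
    · linear_combination sol.eqE5 t ht x
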